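/- arXiv:math/0112256 — 2 statements merged into one kernel-verified Lean document; each statement's English description precedes it below -/
import Mathlib

section
/- The Gårding cone Γ_k^+ = {λ ∈ ℝ^n : σ_j(λ) > 0 for all 1 ≤ j ≤ k} is an open convex cone in ℝ^n. -/
open Finset

noncomputable def esymm (n k : ℕ) (x : Fin n → ℝ) : ℝ :=
  ∑ s ∈ (Finset.univ : Finset (Fin n)).powersetCard k, ∏ i ∈ s, x i

/-- σ_{k}(λ with i-th coordinate deleted) -/
noncomputable def esymmDel (n k : ℕ) (x : Fin n → ℝ) (i : Fin n) : ℝ :=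
  ∑ s ∈ ((Finset.univ : Finset (Fin n)).erase i).powersetCard k, ∏ j ∈ s, x j

def GammaPlus (n k : ℕ) : Set (Fin n → ℝ) :=
  {x | ∀ j : ℕ, 1 ≤ j → j ≤ k → 0 < esymm n j x}

open Polynomial in
/-- generating polynomial of the elementary symmetric functions -/
noncomputable def genP {ι : Type*} (s : Finset ι) (x : ι → ℝ) : Polynomial ℝ :=
  ∏ i ∈ s, (1 + C (x i) * X)

/-- elementary symmetric function on a finset -/
noncomputable def esf {ι : Type*} (s : Finset ι) (k : ℕ) (x : ι → ℝ) : ℝ :=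
  (genP s x).coeff k

open Polynomial in
theorem esymm_eq_esf (n k : ℕ) (x : Fin n → ℝ) : esymm n k x = esf Finset.univ k x := by
  unfold esymm esf genP
  rw [Finset.prod_one_add, Polynomial.finsetSum_coeff]
  have h : ∀ t : Finset (Fin n), (∏ i ∈ t, (C (x i) * X : ℝ[X])).coeff k
      = if t.card = k then ∏ i ∈ t, x i else 0 := by
    intro t
    rw [Finset.prod_mul_distrib, Finset.prod_const, ← map_prod, coeff_C_mul, coeff_X_pow]
    by_cases h : t.card = k
    · simp [h]
    · simp [h, Ne.symm h]
  simp_rw [h]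
  rw [← Finset.sum_filter]
  congr 1
  ext t
  simp [Finset.mem_powersetCard]

theorem splits_derivative (p : Polynomial ℝ) (hp : p.Splits) : p.derivative.Splits := by
  by_cases h0 : p.natDegree = 0
  · rw [Polynomial.derivative_of_natDegree_zero h0]
    exact Polynomial.Splits.zero
  rw [Polynomial.splits_iff_card_roots] at hp ⊢
  have h1 := Polynomial.card_roots_le_derivative p
  have h2 := Polynomial.card_roots' p.derivative
  have h3 := Polynomial.natDegree_derivative_lt h0
  omega

open Polynomial in
theorem newton_zero (p : Polynomial ℝ) (hp : p.Splits) :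
    2 * (p.coeff 0 * p.coeff 2) ≤ p.coeff 1 ^ 2 := by
  obtain ⟨m, hm⟩ := Polynomial.splits_iff_exists_multiset.1 hp
  have key : ∀ m : Multiset ℝ, 2 * ((m.map (fun a => X - C a)).prod.coeff 0 *
      (m.map (fun a => X - C a)).prod.coeff 2) ≤ (m.map (fun a => X - C a)).prod.coeff 1 ^ 2 := by
    intro m
    induction m using Multiset.induction_on with
    | empty => simp [coeff_one]
    | cons a m ih =>
      rw [Multiset.map_cons, Multiset.prod_cons]
      generalize (m.map (fun a => X - C a)).prod = q at ih
      have e0 : ((X - C a) * q).coeff 0 = - a * q.coeff 0 := by simp [sub_mul]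
      have e1 : ((X - C a) * q).coeff 1 = q.coeff 0 - a * q.coeff 1 := by
        simp [sub_mul, coeff_X_mul]
      have e2 : ((X - C a) * q).coeff 2 = q.coeff 1 - a * q.coeff 2 := by
        rw [sub_mul, coeff_sub, coeff_X_mul, coeff_C_mul]
      rw [e0, e1, e2]
      nlinarith [mul_le_mul_of_nonneg_left ih (sq_nonneg a), sq_nonneg (q.coeff 0)]
  rw [hm]
  simp only [coeff_C_mul]
  nlinarith [mul_le_mul_of_nonneg_left (key m) (sq_nonneg p.leadingCoeff)]

theorem newton_all (j : ℕ) : ∀ p : Polynomial ℝ, p.Splits →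
    ((j : ℝ) + 2) * (p.coeff j * p.coeff (j + 2)) ≤ ((j : ℝ) + 1) * p.coeff (j + 1) ^ 2 := by
  induction j with
  | zero =>
    intro p hp
    have := newton_zero p hp
    simpa using this
  | succ j ih =>
    intro p hp
    have h := ih _ (splits_derivative p hp)
    simp only [Polynomial.coeff_derivative] at h
    push_cast at h ⊢
    have hpos : (0 : ℝ) < ((j : ℝ) + 1) * (j + 2) := by positivity
    refine le_of_mul_le_mul_left ?_ hpos
    have e1 : j + 1 + 2 = j + 2 + 1 := by ring
    have e2 : j + 1 + 1 = j + 2 := by ring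
    rw [e1, e2]
    rw [e2] at h
    nlinarith [h]

theorem genP_splits {ι : Type*} (s : Finset ι) (x : ι → ℝ) : (genP s x).Splits := by
  refine Polynomial.Splits.prod fun i _ => Polynomial.Splits.of_natDegree_le_one ?_
  compute_degree

theorem esf_newton {ι : Type*} (s : Finset ι) (x : ι → ℝ) (j : ℕ)
    (h : 0 < esf s j x * esf s (j + 2) x) :
    esf s j x * esf s (j + 2) x < esf s (j + 1) x ^ 2 := by
  have h1 := newton_all j _ (genP_splits s x)
  change ((j : ℝ) + 2) * (esf s j x * esf s (j + 2) x) ≤ ((j : ℝ) + 1) * esf s (j + 1) x ^ 2 at h1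
  have hj : (0 : ℝ) < (j : ℝ) + 1 := by positivity
  refine lt_of_mul_lt_mul_left ?_ hj.le
  linarith

theorem esf_zero {ι : Type*} (s : Finset ι) (x : ι → ℝ) : esf s 0 x = 1 := by
  simp [esf, genP, Polynomial.coeff_zero_prod]

open Polynomial in
theorem esf_succ {ι : Type*} [DecidableEq ι] (s : Finset ι) (x : ι → ℝ) (i : ι) (hi : i ∈ s)
    (k : ℕ) : esf s (k + 1) x = esf (s.erase i) (k + 1) x + x i * esf (s.erase i) k x := by
  unfold esf
  have : genP s x = (1 + C (x i) * X) * genP (s.erase i) x :=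
    (Finset.mul_prod_erase s (fun i => (1 + C (x i) * X : ℝ[X])) hi).symm
  rw [this, add_mul, one_mul, coeff_add, mul_assoc, coeff_C_mul, coeff_X_mul]

open Polynomial in
theorem esf_sum {ι : Type*} [DecidableEq ι] (s : Finset ι) (x : ι → ℝ) (k : ℕ) :
    ((k : ℝ) + 1) * esf s (k + 1) x = ∑ i ∈ s, x i * esf (s.erase i) k x := by
  unfold esf
  rw [mul_comm, ← Polynomial.coeff_derivative]
  unfold genP
  rw [Polynomial.derivative_prod_finset, Polynomial.finsetSum_coeff]
  refine Finset.sum_congr rfl fun i _ => ?_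
  have hd : derivative (1 + C (x i) * X : ℝ[X]) = C (x i) := by simp
  rw [hd, coeff_mul_C, mul_comm]

theorem esf_erase_pos {ι : Type*} [DecidableEq ι] (s : Finset ι) (x : ι → ℝ) (i : ι) (hi : i ∈ s)
    (k : ℕ) (h : ∀ j ≤ k + 1, 0 < esf s j x) : ∀ j ≤ k, 0 < esf (s.erase i) j x := by
  intro j
  induction j with
  | zero => intro _; rw [esf_zero]; norm_num
  | succ j ih =>
    intro hj
    have h0 := ih (by omega)
    have h1 := h (j + 1) (by omega)
    have h2 := h (j + 2) (by omega)
    rw [esf_succ s x i hi] at h1 h2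
    have hn := esf_newton (s.erase i) x j
    by_contra! hc
    generalize esf (s.erase i) j x = p at *
    generalize esf (s.erase i) (j + 1) x = q at *
    generalize esf (s.erase i) (j + 2) x = r at *
    have ht : 0 < x i := by
      by_contra! ht
      nlinarith
    have hr : 0 < r := by nlinarith
    have := hn (mul_pos h0 hr)
    have h3 : x i * (p * r) < x i * q ^ 2 := mul_lt_mul_of_pos_left this ht
    nlinarith [mul_lt_mul_of_pos_left (show -q < x i * p by linarith) hr,
      mul_le_mul_of_nonneg_left (show -(x i * q) ≤ r by linarith) (show 0 ≤ -q by linarith)]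

theorem sq_div_aux (a b A B D : ℝ) (hA : 0 < A) (hB : 0 < B) (hD : A + B ≤ D) :
    (a + b) ^ 2 / D ≤ a ^ 2 / A + b ^ 2 / B := by
  calc (a + b) ^ 2 / D ≤ (a + b) ^ 2 / (A + B) := by gcongr
    _ ≤ _ := by
      rw [div_add_div _ _ hA.ne' hB.ne', div_le_div_iff₀ (by positivity) (by positivity)]
      nlinarith [mul_nonneg (mul_nonneg hA.le hB.le) (sq_nonneg (a * B - b * A)),
        sq_nonneg (a * B - b * A)]

theorem esf_ratio {ι : Type*} [DecidableEq ι] (s : Finset ι) (x : ι → ℝ) (k : ℕ)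
    (h : ∀ j ≤ k + 1, 0 < esf s j x) :
    ((k : ℝ) + 2) * (esf s (k + 2) x / esf s (k + 1) x) =
      ∑ i ∈ s, (x i - x i ^ 2 / (x i + esf (s.erase i) (k + 1) x / esf (s.erase i) k x)) := by
  have h1 := esf_sum s x (k + 1)
  push_cast at h1
  rw [← mul_div_assoc, show (k : ℝ) + 2 = k + 1 + 1 by ring, h1, Finset.sum_div]
  refine Finset.sum_congr rfl fun i hi => ?_
  have h2 := esf_succ s x i hi k
  have h3 := h (k + 1) le_rfl
  have h4 := esf_erase_pos s x i hi k h k le_rfl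
  have h5 : x i + esf (s.erase i) (k + 1) x / esf (s.erase i) k x
      = esf s (k + 1) x / esf (s.erase i) k x := by
    rw [h2]; field_simp; ring
  rw [h5]
  have h6 : esf (s.erase i) (k + 1) x = esf s (k + 1) x - x i * esf (s.erase i) k x := by
    linarith
  rw [h6]
  field_simp

theorem esf_pos_aux {ι : Type*} [DecidableEq ι] (s : Finset ι) (x : ι → ℝ) (k : ℕ) (i : ι)
    (hi : i ∈ s) (h : ∀ j ≤ k + 1, 0 < esf s j x) :
    0 < x i + esf (s.erase i) (k + 1) x / esf (s.erase i) k x := by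
  have h2 := esf_succ s x i hi k
  have h3 := h (k + 1) le_rfl
  have h4 := esf_erase_pos s x i hi k h k le_rfl
  have h5 : x i + esf (s.erase i) (k + 1) x / esf (s.erase i) k x
      = esf s (k + 1) x / esf (s.erase i) k x := by
    rw [h2]; field_simp; ring
  rw [h5]
  positivity

theorem esf_main {ι : Type*} [DecidableEq ι] (k : ℕ) : ∀ (s : Finset ι) (x y : ι → ℝ),
    (∀ j ≤ k, 0 < esf s j x) → (∀ j ≤ k, 0 < esf s j y) →
    (∀ j ≤ k, 0 < esf s j (x + y)) ∧
      esf s (k + 1) x / esf s k x + esf s (k + 1) y / esf s k y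
        ≤ esf s (k + 1) (x + y) / esf s k (x + y) := by
  induction k with
  | zero =>
    intro s x y _ _
    constructor
    · intro j hj
      obtain rfl : j = 0 := by omega
      rw [esf_zero]; norm_num
    · have e : ∀ z : ι → ℝ, esf s 1 z = ∑ i ∈ s, z i := by
        intro z
        have := esf_sum s z 0
        simpa [esf_zero] using this
      simp [esf_zero, e, Finset.sum_add_distrib]
  | succ k ih =>
    intro s x y hx hy
    have hxy : ∀ j ≤ k + 1, 0 < esf s j (x + y) := by
      obtain ⟨ha, hb⟩ := ih s x y (fun j hj => hx j (by omega)) (fun j hj => hy j (by omega))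
      intro j hj
      rcases Nat.lt_or_ge k j with hjk | hjk
      · obtain rfl : j = k + 1 := by omega
        have p1 := div_pos (hx (k + 1) le_rfl) (hx k (by omega))
        have p2 := div_pos (hy (k + 1) le_rfl) (hy k (by omega))
        exact (div_pos_iff_of_pos_right (ha k le_rfl)).1 (by linarith)
      · exact ha j hjk
    refine ⟨hxy, ?_⟩
    have hk : (0 : ℝ) < (k : ℝ) + 2 := by positivity
    refine le_of_mul_le_mul_left ?_ hk
    rw [mul_add]
    rw [show k + 1 + 1 = k + 2 by ring, esf_ratio s x k hx, esf_ratio s y k hy,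
      esf_ratio s _ k hxy, ← Finset.sum_add_distrib]
    refine Finset.sum_le_sum fun i hi => ?_
    have hq := (ih (s.erase i) x y (esf_erase_pos s x i hi k hx)
      (esf_erase_pos s y i hi k hy)).2
    have := sq_div_aux (x i) (y i) _ _
      ((x + y) i + esf (s.erase i) (k + 1) (x + y) / esf (s.erase i) k (x + y))
      (esf_pos_aux s x k i hi hx) (esf_pos_aux s y k i hi hy)
      (by rw [Pi.add_apply]; linarith)
    rw [Pi.add_apply] at this ⊢
    linarith

theorem esymm_smul (n k : ℕ) (c : ℝ) (x : Fin n → ℝ) :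
    esymm n k (c • x) = c ^ k * esymm n k x := by
  unfold esymm
  rw [Finset.mul_sum]
  refine Finset.sum_congr rfl fun s hs => ?_
  rw [Finset.mem_powersetCard] at hs
  simp [Finset.prod_mul_distrib, hs.2]

theorem gamma_smul (n k : ℕ) (c : ℝ) (hc : 0 < c) (x : Fin n → ℝ) (hx : x ∈ GammaPlus n k) :
    c • x ∈ GammaPlus n k := by
  intro j h1 h2
  rw [esymm_smul]
  exact mul_pos (pow_pos hc j) (hx j h1 h2)

theorem gamma_add (n k : ℕ) (x y : Fin n → ℝ) (hx : x ∈ GammaPlus n k)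
    (hy : y ∈ GammaPlus n k) : x + y ∈ GammaPlus n k := by
  have e : ∀ z ∈ GammaPlus n k, ∀ j ≤ k, 0 < esf Finset.univ j z := by
    intro z hz j hj
    rcases Nat.eq_zero_or_pos j with rfl | h
    · rw [esf_zero]; norm_num
    · rw [← esymm_eq_esf]; exact hz j h hj
  intro j _ h2
  rw [esymm_eq_esf]
  exact (esf_main k Finset.univ x y (e x hx) (e y hy)).1 j h2

theorem gamma_open (n k : ℕ) : IsOpen (GammaPlus n k) := by
  have : GammaPlus n k = ⋂ j ∈ Finset.Icc 1 k, {x | 0 < esymm n j x} := by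
    ext x
    simp [GammaPlus]
  rw [this]
  refine isOpen_biInter_finset fun j _ => isOpen_lt continuous_const ?_
  unfold esymm
  fun_prop

theorem stmt_1 (n k : ℕ) (hk : 1 ≤ k) (hkn : k ≤ n) :
    IsOpen (GammaPlus n k) ∧ Convex ℝ (GammaPlus n k) ∧
      ∀ c : ℝ, 0 < c → ∀ x ∈ GammaPlus n k, c • x ∈ GammaPlus n k := by
  refine ⟨gamma_open n k, ?_, fun c hc x hx => gamma_smul n k c hc x hx⟩
  rw [convex_iff_forall_pos]
  intro x hx y hy a b ha hb _
  exact gamma_add n k _ _ (gamma_smul n k a ha x hx) (gamma_smul n k b hb y hy)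
end

section
/- The function λ ↦ σ_k(λ)^{1/k} is concave on the cone Γ_k^+. -/
open Finset

namespace Gar
open Polynomial

/-- Elementary symmetric sums over a finset. -/
noncomputable def e {n : ℕ} (S : Finset (Fin n)) (k : ℕ) (x : Fin n → ℝ) : ℝ :=
  ∑ s ∈ S.powersetCard k, ∏ i ∈ s, x i

lemma e_zero {n : ℕ} (S : Finset (Fin n)) (x : Fin n → ℝ) : e S 0 x = 1 := by
  simp [e]

lemma e_empty {n : ℕ} (k : ℕ) (x : Fin n → ℝ) : e ∅ (k+1) x = 0 := by
  rw [e, Finset.powersetCard_eq_empty.2 (by simp)]; simp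

lemma e_insert {n : ℕ} (S : Finset (Fin n)) (a : Fin n) (ha : a ∉ S) (k : ℕ) (x : Fin n → ℝ) :
    e (insert a S) (k+1) x = e S (k+1) x + x a * e S k x := by
  unfold e
  rw [Finset.powersetCard_succ_insert ha, Finset.sum_union, Finset.sum_image, Finset.mul_sum]
  · congr 1
    refine Finset.sum_congr rfl fun s hs => ?_
    rw [Finset.prod_insert]
    exact fun h => ha ((Finset.mem_powersetCard.1 hs).1 h)
  · intro s hs t ht hst
    have h1 : a ∉ s := fun h => ha ((Finset.mem_powersetCard.1 hs).1 h)
    have h2 : a ∉ t := fun h => ha ((Finset.mem_powersetCard.1 ht).1 h)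
    rw [← Finset.erase_insert h1, ← Finset.erase_insert h2, hst]
  · rw [Finset.disjoint_left]
    intro s hs hs'
    obtain ⟨t, ht, rfl⟩ := Finset.mem_image.1 hs'
    exact ha ((Finset.mem_powersetCard.1 hs).1 (Finset.mem_insert_self a t))

lemma e_erase {n : ℕ} (S : Finset (Fin n)) (a : Fin n) (ha : a ∈ S) (k : ℕ) (x : Fin n → ℝ) :
    e S (k+1) x = e (S.erase a) (k+1) x + x a * e (S.erase a) k x := by
  rw [← e_insert _ _ (Finset.notMem_erase a S), Finset.insert_erase ha]

lemma euler {n : ℕ} (S : Finset (Fin n)) (x : Fin n → ℝ) : ∀ k : ℕ,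
    ∑ i ∈ S, x i * e (S.erase i) k x = (k + 1) * e S (k+1) x := by
  induction S using Finset.induction_on with
  | empty => intro k; rw [e_empty]; simp
  | insert a S ha ih =>
    intro k
    rw [Finset.sum_insert ha, Finset.erase_insert ha, e_insert _ _ ha]
    have hne : ∀ i ∈ S, (insert a S).erase i = insert a (S.erase i) := by
      intro i hi
      rw [Finset.erase_insert_of_ne]
      rintro rfl; exact ha hi
    have hn : ∀ i ∈ S, a ∉ S.erase i := fun i _ h => ha (Finset.mem_of_mem_erase h)
    cases k with
    | zero =>
      have := ih 0
      simp only [e_zero] at this ⊢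
      push_cast at *
      linarith
    | succ k =>
      have : ∑ i ∈ S, x i * e ((insert a S).erase i) (k+1) x
          = ∑ i ∈ S, x i * e (S.erase i) (k+1) x + x a * ∑ i ∈ S, x i * e (S.erase i) k x := by
        rw [Finset.mul_sum, ← Finset.sum_add_distrib]
        refine Finset.sum_congr rfl fun i hi => ?_
        rw [hne i hi, e_insert _ _ (hn i hi)]; ring
      rw [this, ih, ih]; push_cast; ring

lemma splits_deriv {p : ℝ[X]} (hp : p.Splits) : (derivative p).Splits := by
  by_cases h0 : p.natDegree = 0
  · rw [Polynomial.derivative_of_natDegree_zero h0]; exact Splits.zero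
  rw [splits_iff_card_roots] at hp ⊢
  have h1 := card_roots_le_derivative p
  have h2 := natDegree_derivative_le p
  have h3 := card_roots' (derivative p)
  omega

lemma splits_iter {p : ℝ[X]} (hp : p.Splits) (m : ℕ) : (derivative^[m] p).Splits := by
  induction m with
  | zero => exact hp
  | succ m ih => rw [Function.iterate_succ_apply']; exact splits_deriv ih

lemma laguerre {p : ℝ[X]} (hp : p.Splits) :
    2 * p.coeff 0 * p.coeff 2 ≤ p.coeff 1 ^ 2 := by
  induction hp using Submonoid.closure_induction with
  | mem p hp =>
    rcases hp with ⟨a, rfl⟩ | ⟨a, rfl⟩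
    · simp [coeff_C]
    · simp [coeff_C, coeff_X]
  | one => simp [coeff_one]
  | mul p q _ _ hp hq =>
    have h0 : (p * q).coeff 0 = p.coeff 0 * q.coeff 0 := mul_coeff_zero p q
    have h1 : (p * q).coeff 1 = p.coeff 0 * q.coeff 1 + p.coeff 1 * q.coeff 0 := mul_coeff_one p q
    have h2 : (p * q).coeff 2
        = p.coeff 0 * q.coeff 2 + p.coeff 1 * q.coeff 1 + p.coeff 2 * q.coeff 0 := by
      rw [coeff_mul, Finset.Nat.sum_antidiagonal_eq_sum_range_succ_mk]
      simp [Finset.sum_range_succ]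
    rw [h0, h1, h2]
    have := mul_nonneg (sq_nonneg (q.coeff 0)) (sub_nonneg.2 hp)
    have := mul_nonneg (sq_nonneg (p.coeff 0)) (sub_nonneg.2 hq)
    nlinarith

lemma newton_poly {p : ℝ[X]} (hp : p.Splits) (m : ℕ) :
    p.coeff m * p.coeff (m+2) ≤ p.coeff (m+1) ^ 2 := by
  have h := laguerre (splits_iter hp m)
  simp only [coeff_iterate_derivative, nsmul_eq_mul] at h
  have f0 := Nat.factorial_mul_descFactorial (show m ≤ 0 + m by omega)
  have f1 := Nat.factorial_mul_descFactorial (show m ≤ 1 + m by omega)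
  have f2 := Nat.factorial_mul_descFactorial (show m ≤ 2 + m by omega)
  rw [show 0 + m - m = 0 by omega, show 0 + m = m by omega] at f0
  rw [show 1 + m - m = 1 by omega, show 1 + m = m + 1 by omega, Nat.factorial_succ] at f1
  rw [show 2 + m - m = 2 by omega, show 2 + m = m + 1 + 1 by omega, Nat.factorial_succ,
    Nat.factorial_succ] at f2
  rw [show 0 + m = m by omega, show 1 + m = m + 1 by omega, show 2 + m = m + 1 + 1 by omega] at h
  have g0 : (m.descFactorial m : ℝ) = m.factorial := by
    exact_mod_cast (by simpa using f0)
  have g1 : ((m+1).descFactorial m : ℝ) = (m+1) * m.factorial := by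
    exact_mod_cast (by simpa [Nat.factorial_succ] using f1)
  have g2 : 2 * ((m+1+1).descFactorial m : ℝ) = (m+2) * ((m+1) * m.factorial) := by
    exact_mod_cast (by simpa [Nat.factorial] using f2)
  rw [g0, g1] at h
  have hA : (0:ℝ) < m.factorial := by exact_mod_cast m.factorial_pos
  set A : ℝ := (m.factorial : ℝ)
  set D : ℝ := ((m+1+1).descFactorial m : ℝ)
  show p.coeff m * p.coeff (m+1+1) ≤ _
  set a := p.coeff m
  set b := p.coeff (m+1)
  set c := p.coeff (m+1+1)
  have hM : (0:ℝ) ≤ m := Nat.cast_nonneg m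
  have h' : (A^2 * (m+1)) * ((m+2) * (a * c)) ≤ (A^2 * (m+1)) * ((m+1) * b^2) := by
    calc _ = A * a * c * ((m+2) * ((m+1) * A)) := by ring
      _ = 2 * (A * a) * (D * c) := by rw [← g2]; ring
      _ ≤ _ := h
      _ = _ := by ring
  have h'' := le_of_mul_le_mul_left h' (by positivity)
  by_contra hc
  push Not at hc
  nlinarith [sq_nonneg b]

lemma coeff_prod {n : ℕ} (S : Finset (Fin n)) (x : Fin n → ℝ) : ∀ k : ℕ,
    (∏ i ∈ S, (1 + C (x i) * X : ℝ[X])).coeff k = e S k x := by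
  induction S using Finset.induction_on with
  | empty =>
    intro k
    cases k with
    | zero => simp [e_zero]
    | succ k => rw [e_empty]; simp [coeff_one]
  | insert a S ha ih =>
    intro k
    rw [Finset.prod_insert ha]
    cases k with
    | zero => simp only [mul_coeff_zero, ih]; simp [e_zero]
    | succ k =>
      rw [e_insert _ _ ha, add_mul, one_mul, coeff_add, mul_assoc, coeff_C_mul, coeff_X_mul, ih, ih]

lemma newton {n : ℕ} (S : Finset (Fin n)) (x : Fin n → ℝ) (k : ℕ) :
    e S k x * e S (k+2) x ≤ e S (k+1) x ^ 2 := by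
  have h : (∏ i ∈ S, (1 + C (x i) * X : ℝ[X])).Splits := by
    refine Splits.prod fun i _ => Splits.of_natDegree_le_one ?_
    compute_degree
  simpa only [coeff_prod] using newton_poly h k

/-- The Gårding cone over a finset. -/
def G {n : ℕ} (S : Finset (Fin n)) (k : ℕ) (x : Fin n → ℝ) : Prop :=
  ∀ j ≤ k, 0 < e S j x

lemma G_erase {n : ℕ} {S : Finset (Fin n)} {k : ℕ} {x : Fin n → ℝ} (h : G S (k+1) x)
    {i : Fin n} (hi : i ∈ S) : G (S.erase i) k x := by
  intro j
  induction j with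
  | zero => intro _; rw [e_zero]; exact one_pos
  | succ j ih =>
    intro hj
    have ha := ih (by omega)
    have h1 := h (j+1) (by omega)
    have h2 := h (j+2) (by omega)
    rw [e_erase S i hi] at h1 h2
    have hN := newton (S.erase i) x j
    set a := e (S.erase i) j x
    set b := e (S.erase i) (j+1) x
    set c := e (S.erase i) (j+2) x
    change 0 < c + x i * b at h2
    by_contra hb
    push Not at hb
    nlinarith [mul_pos ha h2, mul_nonneg (neg_nonneg.2 hb) h1.le]

lemma key {x y p q r : ℝ} (hp : 0 < p) (hq : 0 < q) (hx : 0 < x + p) (hy : 0 < y + q)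
    (hr : p + q ≤ r) :
    x * p / (x + p) + y * q / (y + q) ≤ (x + y) * r / (x + y + r) := by
  have h1 : x * p / (x + p) + y * q / (y + q) ≤ (x + y) * (p + q) / (x + y + (p + q)) := by
    rw [div_add_div _ _ hx.ne' hy.ne', div_le_div_iff₀ (mul_pos hx hy) (by linarith)]
    nlinarith [sq_nonneg (x * q - y * p)]
  refine h1.trans ?_
  rw [div_le_div_iff₀ (by linarith) (by linarith)]
  nlinarith [mul_nonneg (sq_nonneg (x+y)) (sub_nonneg.2 hr)]

lemma q_formula {n : ℕ} {S : Finset (Fin n)} {k : ℕ} {x : Fin n → ℝ} (h : G S (k+1) x)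
    (h' : ∀ i ∈ S, G (S.erase i) (k+1) x) :
    ((k:ℝ) + 2) * (e S (k+2) x / e S (k+1) x) = ∑ i ∈ S,
      x i * (e (S.erase i) (k+1) x / e (S.erase i) k x) /
        (x i + e (S.erase i) (k+1) x / e (S.erase i) k x) := by
  have := euler S x (k+1)
  push_cast at this
  rw [← mul_div_assoc, show ((k:ℝ)+2) = k+1+1 by ring, ← this, Finset.sum_div]
  refine Finset.sum_congr rfl fun i hi => ?_
  have h0 := h (k+1) le_rfl
  have h1 := h' i hi k (by omega)
  rw [e_erase S i hi] at h0 ⊢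
  have h3 : x i + e (S.erase i) (k+1) x / e (S.erase i) k x =
    (e (S.erase i) (k+1) x + x i * e (S.erase i) k x) / e (S.erase i) k x := by
    field_simp; ring
  rw [h3]
  field_simp

lemma main {n : ℕ} (k : ℕ) : ∀ (S : Finset (Fin n)) (x y : Fin n → ℝ),
    G S (k+1) x → G S (k+1) y → G S (k+1) (x+y) ∧
      e S (k+1) x / e S k x + e S (k+1) y / e S k y ≤ e S (k+1) (x+y) / e S k (x+y) := by
  induction k with
  | zero =>
    intro S x y hx hy
    have h1 : e S 1 (x+y) = e S 1 x + e S 1 y := by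
      have a := euler S x 0
      have b := euler S y 0
      have c := euler S (x+y) 0
      simp only [e_zero, Pi.add_apply, mul_one, Finset.sum_add_distrib] at a b c
      push_cast at a b c
      simp only [zero_add] at a b c
      linarith
    refine ⟨?_, ?_⟩
    · intro j hj
      obtain rfl | rfl : j = 0 ∨ j = 1 := by omega
      · rw [e_zero]; exact one_pos
      · rw [h1]; exact add_pos (hx 1 le_rfl) (hy 1 le_rfl)
    · simp only [e_zero, zero_add, h1, div_one]; exact le_rfl
  | succ k ih =>
    intro S x y hx hy
    have hx1 : G S (k+1) x := fun j hj => hx j (by omega)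
    have hy1 : G S (k+1) y := fun j hj => hy j (by omega)
    have hxy := (ih S x y hx1 hy1).1
    have hxi := fun i hi => G_erase (i := i) hx hi
    have hyi := fun i hi => G_erase (i := i) hy hi
    have hxyi := fun i (hi : i ∈ S) => (ih _ x y (hxi i hi) (hyi i hi)).1
    have hpos : ∀ z : Fin n → ℝ, G S (k+1) z → (∀ i ∈ S, G (S.erase i) (k+1) z) → ∀ i ∈ S,
        0 < z i + e (S.erase i) (k+1) z / e (S.erase i) k z := by
      intro z hz hzi i hi
      have h0 := hz (k+1) le_rfl
      rw [e_erase S i hi] at h0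
      have h1 := hzi i hi k (by omega)
      have h3 : z i + e (S.erase i) (k+1) z / e (S.erase i) k z =
        (e (S.erase i) (k+1) z + z i * e (S.erase i) k z) / e (S.erase i) k z := by
        field_simp; ring
      rw [h3]; exact div_pos h0 h1
    have hineq : e S (k+2) x / e S (k+1) x + e S (k+2) y / e S (k+1) y
        ≤ e S (k+2) (x+y) / e S (k+1) (x+y) := by
      have hk : (0:ℝ) < k + 2 := by positivity
      refine le_of_mul_le_mul_left ?_ hk
      rw [mul_add, q_formula hx1 hxi, q_formula hy1 hyi, q_formula hxy hxyi,
        ← Finset.sum_add_distrib]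
      refine Finset.sum_le_sum fun i hi => ?_
      exact key (div_pos (hxi i hi _ le_rfl) (hxi i hi _ (by omega)))
        (div_pos (hyi i hi _ le_rfl) (hyi i hi _ (by omega)))
        (hpos x hx1 hxi i hi) (hpos y hy1 hyi i hi) (ih _ x y (hxi i hi) (hyi i hi)).2
    refine ⟨?_, hineq⟩
    intro j hj
    rcases Nat.lt_or_ge j (k+2) with h | h
    · exact hxy j (by omega)
    · obtain rfl : j = k + 2 := by omega
      have h1 := div_pos (hx (k+2) le_rfl) (hx1 (k+1) le_rfl)
      have h2 := div_pos (hy (k+2) le_rfl) (hy1 (k+1) le_rfl)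
      have h3 := lt_of_lt_of_le (add_pos h1 h2) hineq
      have h4 := hxy (k+1) le_rfl
      have := mul_pos h3 h4
      rwa [div_mul_cancel₀ _ h4.ne'] at this

lemma G_add {n : ℕ} {S : Finset (Fin n)} {k : ℕ} (hk : 1 ≤ k) {x y : Fin n → ℝ}
    (hx : G S k x) (hy : G S k y) : G S k (x+y) := by
  obtain ⟨k, rfl⟩ : ∃ j, k = j + 1 := ⟨k-1, by omega⟩
  exact (main k S x y hx hy).1

lemma e_smul {n : ℕ} (S : Finset (Fin n)) (k : ℕ) (t : ℝ) (x : Fin n → ℝ) :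
    e S k (t • x) = t ^ k * e S k x := by
  unfold e
  rw [Finset.mul_sum]
  refine Finset.sum_congr rfl fun s hs => ?_
  simp only [Pi.smul_apply, smul_eq_mul, Finset.prod_mul_distrib, Finset.prod_const,
    (Finset.mem_powersetCard.1 hs).2]

lemma G_smul {n : ℕ} {S : Finset (Fin n)} {k : ℕ} {t : ℝ} (ht : 0 < t) {x : Fin n → ℝ}
    (hx : G S k x) : G S k (t • x) := by
  intro j hj
  rw [e_smul]
  exact mul_pos (pow_pos ht _) (hx j hj)

lemma root_bound {k : ℕ} (hk : 1 ≤ k) (a : ℕ → ℝ) (ha : ∀ j ∈ range k, 0 ≤ a j) :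
    (∏ j ∈ range k, a j) ^ ((1:ℝ)/k) ≤ ∑ j ∈ range k, (1:ℝ)/k * a j := by
  have hk' : (k:ℝ) ≠ 0 := by positivity
  have := Real.geom_mean_le_arith_mean_weighted (range k) (fun _ => (1:ℝ)/k) a
    (fun _ _ => by positivity) (by simp [hk']) ha
  rwa [Real.finsetProd_rpow _ _ ha] at this

lemma tele {n : ℕ} {S : Finset (Fin n)} {k : ℕ} {x : Fin n → ℝ} (hx : G S k x) :
    ∀ m ≤ k, ∏ j ∈ range m, (e S (j+1) x / e S j x) = e S m x := by
  intro m
  induction m with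
  | zero => intro _; simp [e_zero]
  | succ m ih =>
    intro hm
    rw [Finset.prod_range_succ, ih (by omega)]
    have := hx m (by omega)
    field_simp

lemma superadd {n : ℕ} {S : Finset (Fin n)} {k : ℕ} (hk : 1 ≤ k) {x y : Fin n → ℝ}
    (hx : G S k x) (hy : G S k y) :
    e S k x ^ ((1:ℝ)/k) + e S k y ^ ((1:ℝ)/k) ≤ e S k (x+y) ^ ((1:ℝ)/k) := by
  have hk' : (k:ℝ) ≠ 0 := by positivity
  have hxy := G_add hk hx hy
  have qpos : ∀ z, G S k z → ∀ j ∈ range k, 0 < e S (j+1) z / e S j z := by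
    intro z hz j hj
    have := Finset.mem_range.1 hj
    exact div_pos (hz _ (by omega)) (hz _ (by omega))
  have hb : ∀ z, G S k z → e S k z ^ ((1:ℝ)/k) / e S k (x+y) ^ ((1:ℝ)/k) ≤ ∑ j ∈ range k,
      (1:ℝ)/k * ((e S (j+1) z / e S j z) / (e S (j+1) (x+y) / e S j (x+y))) := by
    intro z hz
    rw [← Real.div_rpow (hz k le_rfl).le (hxy k le_rfl).le, ← tele hz k le_rfl,
      ← tele hxy k le_rfl, ← Finset.prod_div_distrib]
    exact root_bound hk _ fun j hj => (div_pos (qpos z hz j hj) (qpos _ hxy j hj)).le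
  have hp : 0 < e S k (x+y) ^ ((1:ℝ)/k) := Real.rpow_pos_of_pos (hxy k le_rfl) _
  have h1 := add_le_add (hb x hx) (hb y hy)
  rw [← Finset.sum_add_distrib, ← add_div] at h1
  have h2 : ∑ j ∈ range k, ((1:ℝ)/k * ((e S (j+1) x / e S j x) / (e S (j+1) (x+y) / e S j (x+y)))
      + (1:ℝ)/k * ((e S (j+1) y / e S j y) / (e S (j+1) (x+y) / e S j (x+y))))
      ≤ ∑ j ∈ range k, (1:ℝ)/k := by
    refine Finset.sum_le_sum fun j hj => ?_
    rw [← mul_add, ← add_div]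
    refine mul_le_of_le_one_right (by positivity) ?_
    rw [div_le_one (qpos _ hxy j hj)]
    have := Finset.mem_range.1 hj
    exact (main j S x y (fun i hi => hx i (by omega)) (fun i hi => hy i (by omega))).2
  have h3 : ∑ j ∈ range k, (1:ℝ)/k = 1 := by simp [hk']
  have h4 := h1.trans (h2.trans h3.le)
  rwa [div_le_one hp] at h4

lemma root_smul {n : ℕ} {S : Finset (Fin n)} {k : ℕ} (hk : 1 ≤ k) {t : ℝ} (ht : 0 < t)
    {x : Fin n → ℝ} (hx : G S k x) :
    e S k (t • x) ^ ((1:ℝ)/k) = t * e S k x ^ ((1:ℝ)/k) := by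
  rw [e_smul, Real.mul_rpow (by positivity) (hx k le_rfl).le, one_div,
    Real.pow_rpow_inv_natCast ht.le (by omega)]

lemma mem_iff {n k : ℕ} (x : Fin n → ℝ) : x ∈ GammaPlus n k ↔ G Finset.univ k x := by
  constructor
  · intro h j hj
    rcases Nat.eq_zero_or_pos j with rfl | h0
    · rw [e_zero]; exact one_pos
    · exact h j h0 hj
  · intro h j _ hj
    exact h j hj

end Gar

theorem stmt_4 (n k : ℕ) (hk : 1 ≤ k) (hkn : k ≤ n) :
    ConcaveOn ℝ (GammaPlus n k) (fun x => (esymm n k x) ^ ((1 : ℝ) / k)) := by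
  rw [concaveOn_iff_forall_pos]
  constructor
  · rw [convex_iff_forall_pos]
    intro x hx y hy a b ha hb _
    rw [Gar.mem_iff] at *
    exact Gar.G_add hk (Gar.G_smul ha hx) (Gar.G_smul hb hy)
  · intro x hx y hy a b ha hb _
    rw [Gar.mem_iff] at *
    have h := Gar.superadd hk (Gar.G_smul ha hx) (Gar.G_smul hb hy)
    rw [Gar.root_smul hk ha hx, Gar.root_smul hk hb hy] at h
    exact h
end
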